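/- Let p ≥ 3 be odd and let u : ℝ → ℂ be a continuous 2π-periodic function whose Fourier coefficients satisfy Σ_{k∈ℤ} |û_k| < ∞. Then for every k ∈ ℤ: Σ_{ℓ odd, 1≤ℓ≤p} Σ ( ∏_{i odd} û_{k_i} · ∏_{i even} conj(û_{k_i}) ) = ((p+1)/(4π)) · û_k · ∫₀^{2π} |u(x)|^{p−1} dx, where the inner (absolutely convergent) sum runs over all tuples (k₁,…,k_p) ∈ ℤ^p with k₁ − k₂ + ⋯ + k_p = k and k_ℓ = k. -/

import Mathlib

open scoped BigOperators

/-- The `k`-th Fourier coefficient of a `2π`-periodic function `g : ℝ → ℂ`. -/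
noncomputable def fourierCoef (g : ℝ → ℂ) (k : ℤ) : ℂ :=
  (1 / (2 * Real.pi)) * ∫ x in (0:ℝ)..(2 * Real.pi), g x * Complex.exp (-Complex.I * k * x)

/-- The alternating sum `k₁ − k₂ + k₃ − ⋯ + k_p` (Fin index `j` ↔ paper index `j+1`). -/
def altSum (p : ℕ) (κ : Fin p → ℤ) : ℤ := ∑ j : Fin p, (-1:ℤ)^(j:ℕ) * κ j

/-- The Fourier series of a continuous `2π`-periodic function with absolutely summable Fourier
coefficients converges pointwise to the function. -/
theorem hasSum_fourierCoef_mul_exp {u : ℝ → ℂ} (hu : Continuous u)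
    (hper : Function.Periodic u (2 * Real.pi))
    (hsum : Summable fun k : ℤ => ‖fourierCoef u k‖) (x : ℝ) :
    HasSum (fun m : ℤ => fourierCoef u m * Complex.exp (Complex.I * m * x)) (u x) := by
  have hT : Fact (0 < 2 * Real.pi) := ⟨Real.two_pi_pos⟩
  have hπ : (Real.pi : ℂ) ≠ 0 := Complex.ofReal_ne_zero.mpr Real.pi_ne_zero
  have hexp (n : ℤ) (y : ℝ) : (fourier n (y : AddCircle (2 * Real.pi)) : ℂ)
      = Complex.exp (Complex.I * n * y) := by
    rw [fourier_coe_apply]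
    congr 1
    push_cast
    field_simp
  let f : C(AddCircle (2 * Real.pi), ℂ) := ⟨hper.lift, hu.quotient_lift _⟩
  have hf (y : ℝ) : f (y : AddCircle (2 * Real.pi)) = u y := rfl
  have hcoef : fourierCoeff f = fourierCoef u := by
    funext n
    rw [fourierCoeff_eq_intervalIntegral _ n 0, fourierCoef, Complex.real_smul, zero_add]
    push_cast
    congr 1
    refine intervalIntegral.integral_congr fun y _ => ?_
    simp only [smul_eq_mul]
    rw [hexp, hf, mul_comm]
    push_cast
    ring_nf
  have h := has_pointwise_sum_fourier_series_of_summable (f := f) (hcoef ▸ hsum.of_norm) x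
  simpa only [hcoef, hf, hexp, smul_eq_mul] using h

theorem hasSum_conj_fourierCoef_mul_exp {u : ℝ → ℂ} (hu : Continuous u)
    (hper : Function.Periodic u (2 * Real.pi))
    (hsum : Summable fun k : ℤ => ‖fourierCoef u k‖) (x : ℝ) :
    HasSum (fun m : ℤ => (starRingEnd ℂ) (fourierCoef u m) * Complex.exp (-Complex.I * m * x))
      ((starRingEnd ℂ) (u x)) := by
  have h := Complex.hasSum_conj'.mpr
    ((Complex.conj_conj (u x)).symm ▸ hasSum_fourierCoef_mul_exp hu hper hsum x)
  simpa [← Complex.exp_conj] using h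

/-- A finite product of absolutely convergent series converges absolutely, as a series over
tuples, to the product of the sums. -/
theorem summable_norm_and_hasSum_prod {α : Type*} :
    ∀ {n : ℕ} {f : Fin n → α → ℂ} {c : Fin n → ℂ}, (∀ i, Summable fun m => ‖f i m‖) →
      (∀ i, HasSum (f i) (c i)) →
      (Summable fun κ : Fin n → α => ‖∏ i, f i (κ i)‖) ∧
        HasSum (fun κ : Fin n → α => ∏ i, f i (κ i)) (∏ i, c i)
  | 0, f, c, _, _ => by
    refine ⟨Summable.of_finite, ?_⟩
    simp
  | n + 1, f, c, hf, hc => by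
    obtain ⟨ihs, ih⟩ := summable_norm_and_hasSum_prod (fun i => hf (Fin.succ i))
      (fun i => hc (Fin.succ i))
    have hs := (hf 0).mul_norm ihs
    have hm := (hc 0).mul ih hs.of_norm
    let e : α × (Fin n → α) ≃ (Fin (n + 1) → α) := Fin.consEquiv fun _ => α
    have he (q : α × (Fin n → α)) :
        ∏ i, f i (e q i) = f 0 q.1 * ∏ i : Fin n, f i.succ (q.2 i) := by
      rw [Fin.prod_univ_succ]
      rfl
    constructor
    · rw [← e.summable_iff]
      simpa only [Function.comp_def, he] using hs
    · rw [← e.hasSum_iff, Fin.prod_univ_succ]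
      simpa only [Function.comp_def, he] using hm

theorem integral_exp_I_mul_int (N : ℤ) :
    ∫ x in (0:ℝ)..(2 * Real.pi), Complex.exp (Complex.I * N * x)
      = if N = 0 then 2 * (Real.pi : ℂ) else 0 := by
  split_ifs with h
  · simp [h]
  · rw [integral_exp_mul_complex (mul_ne_zero Complex.I_ne_zero (Int.cast_ne_zero.mpr h))]
    have h1 : Complex.exp (Complex.I * N * ((2 * Real.pi : ℝ) : ℂ)) = 1 := by
      rw [← Complex.exp_int_mul_two_pi_mul_I N]
      congr 1
      push_cast
      ring
    rw [h1]
    simp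

/-- Summing a product of absolutely summable coefficients over the tuples with `∑ i, s i * κ i = 0`
extracts the mean over a period of the product of the corresponding trigonometric series. -/
theorem hasSum_indicator_prod_eq_integral {n : ℕ} {f : Fin n → ℤ → ℂ} {s : Fin n → ℤ}
    {c : Fin n → ℝ → ℂ} (hf : ∀ i, Summable fun m => ‖f i m‖)
    (hc : ∀ i (x : ℝ),
      HasSum (fun m : ℤ => f i m * Complex.exp (Complex.I * (s i * m : ℤ) * x)) (c i x)) :
    HasSum ({κ : Fin n → ℤ | ∑ i, s i * κ i = 0}.indicator fun κ => ∏ i, f i (κ i))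
      (1 / (2 * Real.pi) * ∫ x in (0:ℝ)..(2 * Real.pi), ∏ i, c i x) := by
  have hπ : (Real.pi : ℂ) ≠ 0 := Complex.ofReal_ne_zero.mpr Real.pi_ne_zero
  have hnorm (N : ℤ) (x : ℝ) : ‖Complex.exp (Complex.I * N * x)‖ = 1 := by
    rw [Complex.norm_exp]
    simp
  have hprod (κ : Fin n → ℤ) (x : ℝ) :
      ∏ i, f i (κ i) * Complex.exp (Complex.I * (s i * κ i : ℤ) * x)
        = (∏ i, f i (κ i)) * Complex.exp (Complex.I * (∑ i, s i * κ i : ℤ) * x) := by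
    rw [Finset.prod_mul_distrib, ← Complex.exp_sum]
    congr 2
    push_cast
    rw [Finset.mul_sum, Finset.sum_mul]
  have hs : Summable fun κ : Fin n → ℤ => ‖∏ i, f i (κ i)‖ :=
    (summable_norm_and_hasSum_prod hf fun i => (hf i).of_norm.hasSum).1
  have key := intervalIntegral.hasSum_integral_of_dominated_convergence
    (μ := MeasureTheory.volume) (a := 0) (b := 2 * Real.pi)
    (F := fun (κ : Fin n → ℤ) (x : ℝ) =>
      (∏ i, f i (κ i)) * Complex.exp (Complex.I * (∑ i, s i * κ i : ℤ) * x))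
    (f := fun x => ∏ i, c i x)
    (fun κ _ => ‖∏ i, f i (κ i)‖)
    (fun κ => (by fun_prop : Continuous _).aestronglyMeasurable)
    (fun κ => .of_forall fun x _ => by rw [norm_mul, hnorm, mul_one])
    (.of_forall fun x _ => hs)
    intervalIntegrable_const
    (.of_forall fun x _ => by
      have h := (summable_norm_and_hasSum_prod
        (f := fun i m => f i m * Complex.exp (Complex.I * (s i * m : ℤ) * x))
        (fun i => by simpa only [norm_mul, hnorm, mul_one] using hf i) (fun i => hc i x)).2
      simpa only [hprod] using h)
  convert! key.mul_left (1 / (2 * (Real.pi : ℂ))) using 1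
  funext κ
  rw [intervalIntegral.integral_const_mul, integral_exp_I_mul_int, Set.indicator_apply]
  simp only [Set.mem_ofPred_eq]
  split_ifs
  · field_simp
  · simp

theorem card_filter_even_fin {p : ℕ} (hp : Odd p) :
    (Finset.univ.filter fun i : Fin p => Even (i : ℕ)).card = (p + 1) / 2 := by
  obtain ⟨m, rfl⟩ := hp
  rw [Finset.card_filter, Fin.sum_univ_eq_sum_range (fun i => if Even i then 1 else 0)]
  induction m with
  | zero => rfl
  | succ m ih =>
    have h1 : ¬ Even (2 * m + 1) := by simp
    have h2 : Even (2 * m + 1 + 1) := ⟨m + 1, by ring⟩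
    rw [show 2 * (m + 1) + 1 = 2 * m + 1 + 1 + 1 by ring, Finset.sum_range_succ,
      Finset.sum_range_succ, ih, if_neg h1, if_pos h2]
    omega

theorem prod_erase_ite_conj {p : ℕ} (hp : Odd p) {ℓ : Fin p} (hℓ : Even (ℓ : ℕ)) (z : ℂ) :
    ∏ i ∈ Finset.univ.erase ℓ, (if Even (i : ℕ) then z else (starRingEnd ℂ) z)
      = ((‖z‖ ^ (p - 1) : ℝ) : ℂ) := by
  have hcard := card_filter_even_fin hp
  have heven : ((Finset.univ.erase ℓ).filter fun i : Fin p => Even (i : ℕ)).card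
      = (p - 1) / 2 := by
    rw [Finset.filter_erase, Finset.card_erase_of_mem (by simpa using hℓ), hcard]
    omega
  have hodd : ((Finset.univ.erase ℓ).filter fun i : Fin p => ¬ Even (i : ℕ)).card
      = (p - 1) / 2 := by
    have h := Finset.card_filter_add_card_filter_not (s := Finset.univ.erase ℓ)
      fun i : Fin p => Even (i : ℕ)
    rw [heven, Finset.card_erase_of_mem (Finset.mem_univ ℓ), Finset.card_fin] at h
    obtain ⟨m, rfl⟩ := hp
    omega
  rw [Finset.prod_ite, Finset.prod_const, Finset.prod_const, heven, hodd, ← mul_pow,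
    Complex.mul_conj']
  obtain ⟨m, rfl⟩ := hp
  rw [← pow_mul]
  push_cast
  congr 1
  omega

/-- Identification of the resonant part `R¹`: summing the alternating product over
configurations with one odd-indexed internal frequency equal to the external frequency `k`
(odd paper index `ℓ` ↔ even `Fin p` index) yields `((p+1)/(4π)) û_k ∫₀^{2π}|u|^{p−1} dx`,
all inner sums converging absolutely. -/
theorem stmt9 (p : ℕ) (hp : Odd p) (hp3 : 3 ≤ p)
    (u : ℝ → ℂ) (hu : Continuous u) (hper : Function.Periodic u (2 * Real.pi))
    (hsum : Summable fun k : ℤ => ‖fourierCoef u k‖) (k : ℤ) :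
    (∀ ℓ : Fin p, Even (ℓ:ℕ) →
      Summable (fun κ : {κ : Fin p → ℤ // altSum p κ = k ∧ κ ℓ = k} =>
        ‖∏ i : Fin p, if Even (i:ℕ) then fourierCoef u (κ.1 i)
          else (starRingEnd ℂ) (fourierCoef u (κ.1 i))‖))
    ∧ (∑ ℓ ∈ Finset.univ.filter (fun ℓ : Fin p => Even (ℓ:ℕ)),
        ∑' κ : {κ : Fin p → ℤ // altSum p κ = k ∧ κ ℓ = k},
          ∏ i : Fin p, if Even (i:ℕ) then fourierCoef u (κ.1 i)
            else (starRingEnd ℂ) (fourierCoef u (κ.1 i)))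
      = Complex.ofReal (((p:ℝ) + 1) / (4 * Real.pi)) * fourierCoef u k *
          Complex.ofReal (∫ x in (0:ℝ)..(2 * Real.pi), ‖u x‖ ^ (p - 1)) := by
  classical
  let f : Fin p → ℤ → ℂ := fun i m => if Even (i : ℕ) then fourierCoef u m
    else (starRingEnd ℂ) (fourierCoef u m)
  have hf (i : Fin p) : Summable fun m => ‖f i m‖ := by
    by_cases h : Even (i : ℕ) <;> simpa [f, h] using hsum
  have habs : Summable fun κ : Fin p → ℤ => ‖∏ i, f i (κ i)‖ :=
    (summable_norm_and_hasSum_prod hf fun i => (hf i).of_norm.hasSum).1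
  refine ⟨fun ℓ _ => habs.comp_injective Subtype.val_injective, ?_⟩
  have hval (ℓ : Fin p) (hℓ : Even (ℓ : ℕ)) :
      ∑' κ : {κ : Fin p → ℤ // altSum p κ = k ∧ κ ℓ = k}, ∏ i, f i (κ.1 i)
        = 1 / (2 * Real.pi) * (fourierCoef u k *
          Complex.ofReal (∫ x in (0:ℝ)..(2 * Real.pi), ‖u x‖ ^ (p - 1))) := by
    let v : Fin p → ℝ → ℂ := fun i x => if Even (i : ℕ) then u x else (starRingEnd ℂ) (u x)
    -- Freezing the frequency at `ℓ` to be `k` turns the two constraints into a single linear one.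
    let f' : Fin p → ℤ → ℂ := Function.update f ℓ (Pi.single k (fourierCoef u k))
    let s : Fin p → ℤ := Function.update (fun i => (-1) ^ (i : ℕ)) ℓ 0
    let c : Fin p → ℝ → ℂ := Function.update v ℓ fun _ => fourierCoef u k
    have hf' (i : Fin p) : Summable fun m => ‖f' i m‖ := by
      rcases eq_or_ne i ℓ with rfl | h
      · refine summable_of_ne_finset_zero (s := {k}) fun m hm => ?_
        simp [f', Pi.single_eq_of_ne (Finset.notMem_singleton.mp hm)]
      · simpa [f', h] using hf i
    have hc (i : Fin p) (x : ℝ) :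
        HasSum (fun m : ℤ => f' i m * Complex.exp (Complex.I * (s i * m : ℤ) * x)) (c i x) := by
      rcases eq_or_ne i ℓ with rfl | h
      · simpa [f', s, c] using hasSum_pi_single k (fourierCoef u k)
      · by_cases hi : Even (i : ℕ)
        · simpa [f', s, c, f, v, h, hi] using hasSum_fourierCoef_mul_exp hu hper hsum x
        · simpa [f', s, c, f, v, h, hi, Nat.not_even_iff_odd.mp hi] using
            hasSum_conj_fourierCoef_mul_exp hu hper hsum x
    have hind : {κ : Fin p → ℤ | altSum p κ = k ∧ κ ℓ = k}.indicator (fun κ => ∏ i, f i (κ i))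
        = {κ : Fin p → ℤ | ∑ i, s i * κ i = 0}.indicator fun κ => ∏ i, f' i (κ i) := by
      funext κ
      have hsplit (g : Fin p → ℤ → ℂ) :
          ∏ i, g i (κ i) = g ℓ (κ ℓ) * ∏ i ∈ Finset.univ.erase ℓ, g i (κ i) :=
        (Finset.mul_prod_erase _ _ (Finset.mem_univ ℓ)).symm
      have hrest : ∏ i ∈ Finset.univ.erase ℓ, f' i (κ i)
          = ∏ i ∈ Finset.univ.erase ℓ, f i (κ i) :=
        Finset.prod_congr rfl fun i hi => by simp [f', Finset.ne_of_mem_erase hi]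
      by_cases hk : κ ℓ = k
      · have hprod : ∏ i, f' i (κ i) = ∏ i, f i (κ i) := by
          rw [hsplit, hsplit, hrest]
          simp [f', f, hk, hℓ]
        have hiff : altSum p κ = k ↔ ∑ i, s i * κ i = 0 := by
          have h1 : altSum p κ = κ ℓ + ∑ i ∈ Finset.univ.erase ℓ, (-1) ^ (i : ℕ) * κ i := by
            rw [altSum, ← Finset.add_sum_erase _ _ (Finset.mem_univ ℓ), hℓ.neg_one_pow, one_mul]
          have h2 : ∑ i, s i * κ i = ∑ i ∈ Finset.univ.erase ℓ, (-1) ^ (i : ℕ) * κ i := by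
            rw [← Finset.add_sum_erase _ _ (Finset.mem_univ ℓ)]
            simp only [s, Function.update_self, zero_mul, zero_add]
            exact Finset.sum_congr rfl fun i hi => by simp [Finset.ne_of_mem_erase hi]
          rw [h1, h2, hk]
          omega
        simp only [Set.indicator_apply, Set.mem_ofPred_eq, hprod, hiff, hk, and_true]
      · have hzero : ∏ i, f' i (κ i) = 0 := by
          rw [hsplit]
          simp [f', hk]
        simp [Set.indicator_apply, hk, hzero]
    have hint (x : ℝ) : ∏ i, c i x = fourierCoef u k * ((‖u x‖ ^ (p - 1) : ℝ) : ℂ) := by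
      rw [← Finset.mul_prod_erase _ _ (Finset.mem_univ ℓ), ← prod_erase_ite_conj hp hℓ]
      simp only [c, Function.update_self]
      congr 1
      exact Finset.prod_congr rfl fun i hi => by simp [Finset.ne_of_mem_erase hi, v]
    have h := (hasSum_indicator_prod_eq_integral hf' hc).tsum_eq
    rw [← hind] at h
    simp only [hint, intervalIntegral.integral_const_mul, intervalIntegral.integral_ofReal] at h
    rw [← h]
    exact tsum_subtype {κ : Fin p → ℤ | altSum p κ = k ∧ κ ℓ = k} fun κ => ∏ i, f i (κ i)
  rw [Finset.sum_congr rfl fun ℓ hℓ => hval ℓ (Finset.mem_filter.mp hℓ).2, Finset.sum_const,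
    card_filter_even_fin hp, nsmul_eq_mul]
  have hcast : (((p + 1) / 2 : ℕ) : ℂ) = (p + 1) / 2 := by
    rw [Nat.cast_div hp.add_one.two_dvd two_ne_zero]
    push_cast
    rfl
  rw [hcast]
  push_cast
  ring
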